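/- Let Θ₀ = {R₀, M₀, N₀, L₀} be a minimizer of J(g, Θ) over system responses Θ satisfying the SLS constraints for the true plant (Z, e₁, gᵀ), let g̃ ∈ ℝ^{r−1} satisfy ‖g − g̃‖₂ ≤ ε with ε < 1/(2‖N₀‖), and let (Θ̃*, α*) be a minimizer of the robust SLS problem for g̃ with uncertainty parameter ε. Then the controller K̃* = L̃* − M̃*R̃*⁻¹Ñ* internally stabilizes the true plant (Z, e₁, gᵀ), and the closed-loop response Θ̂* it achieves on the true plant satisfies J(g, Θ̂*) − J(g, Θ₀) ≤ (2ε / (1 − 2ε‖N₀‖)) · ‖[1 + gᵀN₀; L₀]‖ · ‖R₀B₁ + N₀D₂₁‖. -/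

import Mathlib

/- Preliminaries: transfer functions as real rational functions, RH∞, H∞ norms,
   System-Level Synthesis (SLS) constraints, controllers, closed-loop responses,
   coarse-grained identification, Gaussian vectors. -/

noncomputable section
open scoped Matrix BigOperators ENNReal
open MeasureTheory ProbabilityTheory Polynomial

namespace SLS

/-- Scalar transfer functions: real rational functions in `z`. -/
abbrev TF : Type := RatFunc ℝ

/-- Transfer matrices. -/
abbrev TMat (m n : ℕ) : Type := Matrix (Fin m) (Fin n) TF

/-- Embed a real matrix as a (constant) transfer matrix. -/
def rmap {m n : ℕ} (A : Matrix (Fin m) (Fin n) ℝ) : TMat m n := A.map RatFunc.C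

/-- Evaluate a scalar transfer function at a complex point. -/
def evalTF (f : TF) (z : ℂ) : ℂ :=
  (f.num.map (algebraMap ℝ ℂ)).eval z / (f.denom.map (algebraMap ℝ ℂ)).eval z

/-- Evaluate a transfer matrix at a complex point. -/
def evalMat {m n : ℕ} (F : TMat m n) (z : ℂ) : Matrix (Fin m) (Fin n) ℂ :=
  Matrix.of fun i j => evalTF (F i j) z

/-- Spectral norm (ℓ2 → ℓ2 operator norm) of a matrix over `ℝ` or `ℂ`. -/
def specNorm {𝕜 : Type} [RCLike 𝕜] {m n : ℕ} (M : Matrix (Fin m) (Fin n) 𝕜) : ℝ :=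
  ‖LinearMap.toContinuousLinearMap (Matrix.toEuclideanLin M)‖

/-- H∞ norm of a transfer matrix: sup over the unit circle of the spectral norm. -/
def hinfNorm {m n : ℕ} (F : TMat m n) : ℝ :=
  sSup {x : ℝ | ∃ z : ℂ, ‖z‖ = 1 ∧ x = specNorm (evalMat F z)}

/-- H∞ norm of a scalar transfer function. -/
def hinfNormTF (f : TF) : ℝ :=
  sSup {x : ℝ | ∃ z : ℂ, ‖z‖ = 1 ∧ x = ‖evalTF f z‖}

/-- A scalar transfer function is proper if its numerator degree does not exceed
its denominator degree. -/
def ProperTF (f : TF) : Prop := f.num.degree ≤ f.denom.degree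

/-- Strictly proper: vanishes at `z = ∞`. -/
def StrictlyProperTF (f : TF) : Prop := f.num.degree < f.denom.degree

/-- Stable: all poles lie strictly inside the open unit disk. -/
def StableTF (f : TF) : Prop :=
  ∀ z : ℂ, (f.denom.map (algebraMap ℝ ℂ)).eval z = 0 → ‖z‖ < 1

/-- Membership in RH∞ for scalar transfer functions: proper and stable. -/
def MemRHinfTF (f : TF) : Prop := ProperTF f ∧ StableTF f

/-- Membership in RH∞ for transfer matrices (entrywise). -/
def MemRHinf {m n : ℕ} (F : TMat m n) : Prop := ∀ i j, MemRHinfTF (F i j)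

/-- Strict properness of a transfer matrix (entrywise). -/
def StrictlyProper {m n : ℕ} (F : TMat m n) : Prop := ∀ i j, StrictlyProperTF (F i j)

/-- The transfer matrix `zI - A` for a real matrix `A`. -/
def zIA {n : ℕ} (A : Matrix (Fin n) (Fin n) ℝ) : TMat n n :=
  Matrix.diagonal (fun _ => (RatFunc.X : TF)) - rmap A

/-- A system response `Θ = {R, M, N, L}` for a plant with `n` states, `p` control
inputs and `q` measured outputs. -/
structure Response (n p q : ℕ) where
  R : TMat n n
  M : TMat p n
  N : TMat n q
  L : TMat p q

/-- The stability part of the SLS constraints: `R, M, N` strictly proper in RH∞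
and `L ∈ RH∞`. -/
def SLSStable {n p q : ℕ} (Θ : Response n p q) : Prop :=
  StrictlyProper Θ.R ∧ StrictlyProper Θ.M ∧ StrictlyProper Θ.N ∧
  MemRHinf Θ.R ∧ MemRHinf Θ.M ∧ MemRHinf Θ.N ∧ MemRHinf Θ.L

/-- The SLS constraints for the plant `(A, B₂, C₂)`:
`[zI − A, −B₂]·[[R, N],[M, L]] = [I, 0]`, `[[R, N],[M, L]]·[zI − A; −C₂] = [I; 0]`,
written blockwise, together with the stability conditions. -/
def SLSConstraints {n p q : ℕ} (A : Matrix (Fin n) (Fin n) ℝ)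
    (B₂ : Matrix (Fin n) (Fin p) ℝ) (C₂ : Matrix (Fin q) (Fin n) ℝ)
    (Θ : Response n p q) : Prop :=
  zIA A * Θ.R - rmap B₂ * Θ.M = 1 ∧
  zIA A * Θ.N - rmap B₂ * Θ.L = 0 ∧
  Θ.R * zIA A - Θ.N * rmap C₂ = 1 ∧
  Θ.M * zIA A - Θ.L * rmap C₂ = 0 ∧
  SLSStable Θ

/-- The robust SLS constraints with perturbations `(Δ₁, Δ₂)`: the second block
equation becomes `[[R, N],[M, L]]·[zI − A; −C₂] = [I + Δ₁; Δ₂]`. -/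
def RobustSLSConstraints {n p q : ℕ} (A : Matrix (Fin n) (Fin n) ℝ)
    (B₂ : Matrix (Fin n) (Fin p) ℝ) (C₂ : Matrix (Fin q) (Fin n) ℝ)
    (Δ₁ : TMat n n) (Δ₂ : TMat p n) (Θ : Response n p q) : Prop :=
  zIA A * Θ.R - rmap B₂ * Θ.M = 1 ∧
  zIA A * Θ.N - rmap B₂ * Θ.L = 0 ∧
  Θ.R * zIA A - Θ.N * rmap C₂ = 1 + Δ₁ ∧
  Θ.M * zIA A - Θ.L * rmap C₂ = Δ₂ ∧
  SLSStable Θ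

/-- The controller `K = L − M R⁻¹ N` induced by a system response. -/
def controller {n p q : ℕ} (Θ : Response n p q) : TMat p q :=
  Θ.L - Θ.M * Θ.R⁻¹ * Θ.N

/-- `K` achieves the closed-loop response `Θ'` on the plant `(A, B₂, C₂)`: in the
feedback loop `x = (zI − A)⁻¹(B₂u + δx)`, `y = C₂x + δy`, `u = Ky`, the transfer
matrices from `(δx, δy)` to `(x, u)` equal `[[R', N'],[M', L']]`. -/
def Achieves {n p q : ℕ} (A : Matrix (Fin n) (Fin n) ℝ)
    (B₂ : Matrix (Fin n) (Fin p) ℝ) (C₂ : Matrix (Fin q) (Fin n) ℝ)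
    (K : TMat p q) (Θ' : Response n p q) : Prop :=
  zIA A * Θ'.R = rmap B₂ * Θ'.M + 1 ∧
  zIA A * Θ'.N = rmap B₂ * Θ'.L ∧
  Θ'.M = K * rmap C₂ * Θ'.R ∧
  Θ'.L = K * rmap C₂ * Θ'.N + K

/-- `K` internally stabilizes the plant `(A, B₂, C₂)`: the four closed-loop
transfer matrices exist, `R', M', N'` are strictly proper, and all four lie in RH∞. -/
def InternallyStabilizes {n p q : ℕ} (A : Matrix (Fin n) (Fin n) ℝ)
    (B₂ : Matrix (Fin n) (Fin p) ℝ) (C₂ : Matrix (Fin q) (Fin n) ℝ)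
    (K : TMat p q) : Prop :=
  ∃ Θ' : Response n p q, Achieves A B₂ C₂ K Θ' ∧ SLSStable Θ'

/-! ### FIR SISO plants -/

/-- The down-shift matrix (ones on the subdiagonal). -/
def shiftMat (n : ℕ) : Matrix (Fin n) (Fin n) ℝ :=
  Matrix.of fun i j => if (i : ℕ) = (j : ℕ) + 1 then 1 else 0

/-- The first standard basis vector, as a column matrix. -/
def e1 (n : ℕ) : Matrix (Fin n) (Fin 1) ℝ :=
  Matrix.of fun i _ => if (i : ℕ) = 0 then 1 else 0

/-- A vector as a row matrix (`gᵀ`). -/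
def rowVec {n : ℕ} (g : Fin n → ℝ) : Matrix (Fin 1) (Fin n) ℝ :=
  Matrix.of fun _ j => g j

/-- The matrix `C₁ = [gᵀ; 0]`. -/
def C1mat {n : ℕ} (g : Fin n → ℝ) : Matrix (Fin 2) (Fin n) ℝ :=
  Matrix.of fun i j => if (i : ℕ) = 0 then g j else 0

/-- The matrix `D₁₂ = [0; 1]`. -/
def D12mat : Matrix (Fin 2) (Fin 1) ℝ :=
  Matrix.of fun i _ => if (i : ℕ) = 1 then 1 else 0

/-- Stack two scalar transfer functions into a 2×1 transfer matrix `[a; b]`. -/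
def col2 (a b : TF) : TMat 2 1 :=
  Matrix.of fun i _ => if (i : ℕ) = 0 then a else b

/-- The H∞ cost `J(g, Θ) = ‖[C₁, D₁₂]·[[R, N],[M, L]]·[B₁; D₂₁] + D₁₁‖` of a
system response for the generalized plant built from FIR coefficients `g`. -/
def cost {n nw : ℕ} (g : Fin n → ℝ) (B₁ : Matrix (Fin n) (Fin nw) ℝ)
    (D₂₁ : Matrix (Fin 1) (Fin nw) ℝ) (D₁₁ : Matrix (Fin 2) (Fin nw) ℝ)
    (Θ : Response n 1 1) : ℝ :=
  hinfNorm ((rmap (C1mat g) * Θ.R + rmap D12mat * Θ.M) * rmap B₁ +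
    (rmap (C1mat g) * Θ.N + rmap D12mat * Θ.L) * rmap D₂₁ + rmap D₁₁)

/-- The transfer matrix `[1 + g̃ᵀÑ; L̃]` and its H∞ norm. -/
def perfWeight {n : ℕ} (g : Fin n → ℝ) (Θ : Response n 1 1) : ℝ :=
  hinfNorm (col2 (1 + (rmap (rowVec g) * Θ.N) 0 0) (Θ.L 0 0))

/-- The robust SLS objective `Q(g̃, Θ̃, α) = J(g̃, Θ̃) + εα‖R̃B₁ + ÑD₂₁‖`. -/
def Qval {n nw : ℕ} (g : Fin n → ℝ) (B₁ : Matrix (Fin n) (Fin nw) ℝ)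
    (D₂₁ : Matrix (Fin 1) (Fin nw) ℝ) (D₁₁ : Matrix (Fin 2) (Fin nw) ℝ)
    (ε : ℝ) (Θ : Response n 1 1) (α : ℝ) : ℝ :=
  cost g B₁ D₂₁ D₁₁ Θ + ε * α * hinfNorm (Θ.R * rmap B₁ + Θ.N * rmap D₂₁)

/-- Feasibility for the robust SLS problem for the estimate `g̃` with uncertainty
parameter `ε`: `α > 0`, `Θ̃` satisfies the SLS constraints for `(Z, e₁, g̃ᵀ)`, and
`εα‖Ñ‖ + ‖[1 + g̃ᵀÑ; L̃]‖ ≤ α`. -/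
def RobustFeasible {n : ℕ} (g : Fin n → ℝ) (ε : ℝ) (Θ : Response n 1 1) (α : ℝ) : Prop :=
  0 < α ∧ SLSConstraints (shiftMat n) (e1 n) (rowVec g) Θ ∧
  ε * α * hinfNorm Θ.N + perfWeight g Θ ≤ α

/-- `(Θ̃, α)` is a minimizer of the robust SLS problem for `g̃`. -/
def RobustOptimal {n nw : ℕ} (g : Fin n → ℝ) (B₁ : Matrix (Fin n) (Fin nw) ℝ)
    (D₂₁ : Matrix (Fin 1) (Fin nw) ℝ) (D₁₁ : Matrix (Fin 2) (Fin nw) ℝ)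
    (ε : ℝ) (Θ : Response n 1 1) (α : ℝ) : Prop :=
  RobustFeasible g ε Θ α ∧
  ∀ Θ' α', RobustFeasible g ε Θ' α' → Qval g B₁ D₂₁ D₁₁ ε Θ α ≤ Qval g B₁ D₂₁ D₁₁ ε Θ' α'

/-- `Θ₀` is a minimizer of `J(g, ·)` over responses satisfying the SLS constraints
for the plant `(Z, e₁, gᵀ)`. -/
def OptimalResponse {n nw : ℕ} (g : Fin n → ℝ) (B₁ : Matrix (Fin n) (Fin nw) ℝ)
    (D₂₁ : Matrix (Fin 1) (Fin nw) ℝ) (D₁₁ : Matrix (Fin 2) (Fin nw) ℝ)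
    (Θ : Response n 1 1) : Prop :=
  SLSConstraints (shiftMat n) (e1 n) (rowVec g) Θ ∧
  ∀ Θ', SLSConstraints (shiftMat n) (e1 n) (rowVec g) Θ' →
    cost g B₁ D₂₁ D₁₁ Θ ≤ cost g B₁ D₂₁ D₁₁ Θ'

/-- The FIR transfer function `G(z) = Σ_{t=1}^{r−1} g_t z^{−t}` for
`g = (g₁, …, g_{r−1})`. -/
def firTF {n : ℕ} (g : Fin n → ℝ) : TF :=
  ∑ t : Fin n, RatFunc.C (g t) * (RatFunc.X)⁻¹ ^ ((t : ℕ) + 1)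

/-- The FIR transfer function `G(z) = Σ_{k=0}^{T−1} g_k z^{−k}` for a full
impulse-response vector `g_{0:T−1}`. -/
def firTF0 {T : ℕ} (g : Fin T → ℝ) : TF :=
  ∑ k : Fin T, RatFunc.C (g k) * (RatFunc.X)⁻¹ ^ (k : ℕ)

/-! ### Coarse-grained identification -/

/-- Euclidean (ℓ2) norm of a finite real vector. -/
def euclNorm {r : ℕ} (x : Fin r → ℝ) : ℝ := Real.sqrt (∑ i, x i ^ 2)

/-- ℓp norm of a finite real vector, `p ∈ [1, ∞]`. -/
def lpNorm {T : ℕ} (p : ℝ≥0∞) (x : Fin T → ℝ) : ℝ :=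
  if p = ∞ then ⨆ i, |x i| else (∑ i, |x i| ^ p.toReal) ^ (1 / p.toReal)

/-- `r^{2/max(p,2)}` as a real number. -/
def rExp (p : ℝ≥0∞) (r : ℕ) : ℝ := (r : ℝ) ^ ((2 / max p 2).toReal)

/-- The T×T lower-triangular Toeplitz matrix whose first column is `u`. -/
def toep {T : ℕ} (u : Fin T → ℝ) : Matrix (Fin T) (Fin T) ℝ :=
  Matrix.of fun i j =>
    if (j : ℕ) ≤ (i : ℕ) then u ⟨(i : ℕ) - (j : ℕ), lt_of_le_of_lt (Nat.sub_le _ _) i.isLt⟩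
    else 0

/-- The stacked input matrix `Z_mat = [Toep(u₁); …; Toep(u_m)]`. -/
def Zmat {T mE : ℕ} (u : Fin mE → Fin T → ℝ) : Matrix (Fin mE × Fin T) (Fin T) ℝ :=
  Matrix.of fun pr j => toep (u pr.1) pr.2 j

/-- `Z_matᵀ Z_mat`. -/
def ZtZ {T mE : ℕ} (u : Fin mE → Fin T → ℝ) : Matrix (Fin T) (Fin T) ℝ :=
  (Zmat u)ᵀ * Zmat u

/-- The least-squares estimate `g̃_{0:T−1} = (Z_matᵀZ_mat)⁻¹Z_matᵀ(y₁; …; y_m)`. -/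
def lsEst {T mE : ℕ} (u : Fin mE → Fin T → ℝ) (y : Fin mE → Fin T → ℝ) : Fin T → ℝ :=
  ((ZtZ u)⁻¹ * (Zmat u)ᵀ).mulVec fun pr => y pr.1 pr.2

/-- Pad the FIR coefficients `g = (g₁, …, g_{r−1})` to the impulse response
`g_{0:T−1} = (0, g₁, …, g_{r−1}, 0, …, 0)`. -/
def pad {r T : ℕ} (_ : r ≤ T) (g : Fin (r - 1) → ℝ) : Fin T → ℝ := fun k =>
  if hk : 1 ≤ (k : ℕ) ∧ (k : ℕ) < r then g ⟨(k : ℕ) - 1, by omega⟩ else 0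

/-- The estimated FIR coefficients `g̃ = (g̃₁, …, g̃_{r−1})` from coarse-grained
identification with true coefficients `g` and additive noise on the outputs. -/
def coarseEst {r T mE : ℕ} (hrT : r ≤ T) (u : Fin mE → Fin T → ℝ)
    (g : Fin (r - 1) → ℝ) (noise : Fin mE → Fin T → ℝ) : Fin (r - 1) → ℝ :=
  fun i =>
    lsEst u (fun k => (toep (u k)).mulVec (pad hrT g) + noise k)
      ⟨(i : ℕ) + 1, by have := i.isLt; omega⟩

/-! ### Gaussian random vectors -/

/-- The standard Gaussian measure on `Fin r → ℝ` (i.i.d. `N(0,1)` coordinates). -/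
def stdGaussianPi (r : ℕ) : Measure (Fin r → ℝ) :=
  Measure.pi fun _ => gaussianReal 0 1

/-- `δ` is a centered Gaussian random vector with covariance `Cov`: its law is the
pushforward of the standard Gaussian under some `A` with `AAᵀ = Cov`. -/
def IsCenteredGaussianVec {Ω : Type} [MeasurableSpace Ω] (P : Measure Ω) {r : ℕ}
    (δ : Ω → Fin r → ℝ) (Cov : Matrix (Fin r) (Fin r) ℝ) : Prop :=
  ∃ A : Matrix (Fin r) (Fin r) ℝ, A * Aᵀ = Cov ∧
    Measure.map δ P = Measure.map (fun x => A.mulVec x) (stdGaussianPi r)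

/-- The law of i.i.d. `N(0, σ²)` noise across `mE` experiments of length `T`. -/
def iidGaussianLaw (mE T : ℕ) (σ2 : ℝ) : Measure (Fin mE → Fin T → ℝ) :=
  Measure.pi fun _ => Measure.pi fun _ => gaussianReal 0 σ2.toNNReal


/-- Scalar multiplication of a transfer matrix by a scalar transfer function. -/
def sMulTF {m n : ℕ} (c : TF) (M : TMat m n) : TMat m n := Matrix.of fun i j => c * M i j

/-- The perturbed response `Θ̂` with `R̂ = (I+Δ₁)⁻¹R̃`, `M̂ = M̃ − Δ₂(I+Δ₁)⁻¹R̃`,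
`N̂ = (I+Δ₁)⁻¹Ñ`, `L̂ = L̃ − Δ₂(I+Δ₁)⁻¹Ñ` (with the rational matrix inverse). -/
def deltaPerturb {n p q : ℕ} (Δ₁ : TMat n n) (Δ₂ : TMat p n) (Θ : Response n p q) :
    Response n p q where
  R := (1 + Δ₁)⁻¹ * Θ.R
  M := Θ.M - Δ₂ * ((1 + Δ₁)⁻¹ * Θ.R)
  N := (1 + Δ₁)⁻¹ * Θ.N
  L := Θ.L - Δ₂ * ((1 + Δ₁)⁻¹ * Θ.N)

/-- The Sherman–Morrison form of the perturbed response in the FIR SISO case: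
`[[R̂, N̂],[M̂, L̂]] = [[R̃, Ñ],[M̃, L̃]] + (1 − δᵀÑ)⁻¹·[Ñδᵀ; L̃δᵀ]·[R̃, Ñ]`. -/
def smPerturb {n : ℕ} (δ : Fin n → ℝ) (Θ : Response n 1 1) : Response n 1 1 where
  R := Θ.R + sMulTF (1 - (rmap (rowVec δ) * Θ.N) 0 0)⁻¹ (Θ.N * rmap (rowVec δ) * Θ.R)
  M := Θ.M + sMulTF (1 - (rmap (rowVec δ) * Θ.N) 0 0)⁻¹ (Θ.L * rmap (rowVec δ) * Θ.R)
  N := Θ.N + sMulTF (1 - (rmap (rowVec δ) * Θ.N) 0 0)⁻¹ (Θ.N * rmap (rowVec δ) * Θ.N)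
  L := Θ.L + sMulTF (1 - (rmap (rowVec δ) * Θ.N) 0 0)⁻¹ (Θ.L * rmap (rowVec δ) * Θ.N)

/-- The block-diagonal matrix with `m` copies of `Toep(g)` on the diagonal
(the action of `Toep(g)` on the stacked process noise of `m` experiments). -/
def bigToep {T mE : ℕ} (g : Fin T → ℝ) : Matrix (Fin mE × Fin T) (Fin mE × Fin T) ℝ :=
  Matrix.of fun pr qr => if pr.1 = qr.1 then toep g pr.2 qr.2 else 0

end SLS

open SLS

namespace SLSProof

/-! ### Scalar transfer functions -/

theorem evalTF_eq (f : TF) (z : ℂ) : evalTF f z = RatFunc.eval (algebraMap ℝ ℂ) z f := by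
  simp [evalTF, RatFunc.eval, Polynomial.eval_map]

open Classical in
abbrev vinf : Valuation TF (WithZero (Multiplicative ℤ)) := RatFunc.inftyValuation ℝ

theorem intDegree_def' (f : TF) :
    f.intDegree = (f.num.natDegree : ℤ) - (f.denom.natDegree : ℤ) := rfl

theorem proper_iff (f : TF) : ProperTF f ↔ vinf f ≤ 1 := by
  classical
  by_cases hf : f = 0
  · subst hf
    simp [ProperTF]
  · have h1 : f.num ≠ 0 := RatFunc.num_ne_zero hf
    have h2 : f.denom ≠ 0 := RatFunc.denom_ne_zero f
    rw [RatFunc.inftyValuation_apply, RatFunc.inftyValuation_of_nonzero ℝ hf,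
      ← WithZero.exp_zero, WithZero.exp_le_exp, intDegree_def', ProperTF,
      Polynomial.degree_eq_natDegree h1, Polynomial.degree_eq_natDegree h2, Nat.cast_le]
    omega

theorem sproper_iff (f : TF) : StrictlyProperTF f ↔ vinf f < 1 := by
  classical
  by_cases hf : f = 0
  · subst hf
    simp [StrictlyProperTF]
  · have h1 : f.num ≠ 0 := RatFunc.num_ne_zero hf
    have h2 : f.denom ≠ 0 := RatFunc.denom_ne_zero f
    rw [RatFunc.inftyValuation_apply, RatFunc.inftyValuation_of_nonzero ℝ hf,
      ← WithZero.exp_zero, WithZero.exp_lt_exp, intDegree_def', StrictlyProperTF,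
      Polynomial.degree_eq_natDegree h1, Polynomial.degree_eq_natDegree h2, Nat.cast_lt]
    omega

theorem stable_of_dvd {f : TF} {p : ℝ[X]} (h : f.denom ∣ p)
    (hp : ∀ z : ℂ, (p.map (algebraMap ℝ ℂ)).eval z = 0 → ‖z‖ < 1) : StableTF f := by
  intro z hz
  apply hp
  obtain ⟨q, rfl⟩ := h
  simp [hz]

theorem stable_mul_aux {f g : TF} (hf : StableTF f) (hg : StableTF g) (z : ℂ)
    (hz : ((f.denom * g.denom).map (algebraMap ℝ ℂ)).eval z = 0) : ‖z‖ < 1 := by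
  rw [Polynomial.map_mul, Polynomial.eval_mul, mul_eq_zero] at hz
  exact hz.elim (hf z) (hg z)

theorem rh_add {f g : TF} (hf : MemRHinfTF f) (hg : MemRHinfTF g) : MemRHinfTF (f + g) := by
  refine ⟨?_, stable_of_dvd (RatFunc.denom_add_dvd f g) (stable_mul_aux hf.2 hg.2)⟩
  rw [proper_iff]
  exact vinf.map_add_le ((proper_iff f).1 hf.1) ((proper_iff g).1 hg.1)

theorem rh_mul {f g : TF} (hf : MemRHinfTF f) (hg : MemRHinfTF g) : MemRHinfTF (f * g) := by
  refine ⟨?_, stable_of_dvd (RatFunc.denom_mul_dvd f g) (stable_mul_aux hf.2 hg.2)⟩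
  rw [proper_iff, map_mul]
  exact mul_le_one' ((proper_iff f).1 hf.1) ((proper_iff g).1 hg.1)

theorem rh_C (a : ℝ) : MemRHinfTF (RatFunc.C a) := by
  constructor
  · simp only [ProperTF, RatFunc.num_C, RatFunc.denom_C]
    rw [Polynomial.degree_one]
    exact Polynomial.degree_C_le
  · intro z hz
    simp at hz

theorem rh_zero : MemRHinfTF 0 := by simpa using rh_C 0

theorem rh_one : MemRHinfTF 1 := by simpa using rh_C 1

theorem rh_sum {ι : Type} (s : Finset ι) (f : ι → TF) (hf : ∀ i, MemRHinfTF (f i)) :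
    MemRHinfTF (∑ i ∈ s, f i) := by
  classical
  induction s using Finset.induction_on with
  | empty => simpa using rh_zero
  | insert a s ha ih => rw [Finset.sum_insert ha]; exact rh_add (hf a) ih

theorem sp_zero : StrictlyProperTF 0 := by simp [StrictlyProperTF]

theorem sp_add {f g : TF} (hf : StrictlyProperTF f) (hg : StrictlyProperTF g) :
    StrictlyProperTF (f + g) := by
  rw [sproper_iff] at *
  exact vinf.map_add_lt hf hg

theorem sp_mul_left {f g : TF} (hf : ProperTF f) (hg : StrictlyProperTF g) :
    StrictlyProperTF (f * g) := by
  rw [sproper_iff] at *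
  rw [proper_iff] at hf
  rw [map_mul]
  exact (mul_le_of_le_one_left' hf).trans_lt hg

theorem sp_mul_right {f g : TF} (hf : StrictlyProperTF f) (hg : ProperTF g) :
    StrictlyProperTF (f * g) := by
  rw [mul_comm]; exact sp_mul_left hg hf

theorem sp_sum {ι : Type} (s : Finset ι) (f : ι → TF) (hf : ∀ i, StrictlyProperTF (f i)) :
    StrictlyProperTF (∑ i ∈ s, f i) := by
  classical
  induction s using Finset.induction_on with
  | empty => simpa using sp_zero
  | insert a s ha ih => rw [Finset.sum_insert ha]; exact sp_add (hf a) ih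

theorem denom_ne {f : TF} (hf : StableTF f) {z : ℂ} (hz : 1 ≤ ‖z‖) :
    Polynomial.eval₂ (algebraMap ℝ ℂ) z f.denom ≠ 0 := by
  intro h
  have := hf z (by rw [Polynomial.eval_map]; exact h)
  linarith

theorem ev_add {f g : TF} (hf : MemRHinfTF f) (hg : MemRHinfTF g) {z : ℂ} (hz : 1 ≤ ‖z‖) :
    evalTF (f + g) z = evalTF f z + evalTF g z := by
  simp only [evalTF_eq]
  exact RatFunc.eval_add _ _ (denom_ne hf.2 hz) (denom_ne hg.2 hz)

theorem ev_mul {f g : TF} (hf : MemRHinfTF f) (hg : MemRHinfTF g) {z : ℂ} (hz : 1 ≤ ‖z‖) :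
    evalTF (f * g) z = evalTF f z * evalTF g z := by
  simp only [evalTF_eq]
  exact RatFunc.eval_mul _ _ (denom_ne hf.2 hz) (denom_ne hg.2 hz)

theorem ev_C (a : ℝ) (z : ℂ) : evalTF (RatFunc.C a) z = (a : ℂ) := by
  simp [evalTF_eq]

theorem ev_one (z : ℂ) : evalTF 1 z = 1 := by
  simp [evalTF_eq]

theorem ev_zero (z : ℂ) : evalTF 0 z = 0 := by
  simp [evalTF_eq]

theorem ev_sum {ι : Type} (s : Finset ι) (f : ι → TF) (hf : ∀ i, MemRHinfTF (f i)) {z : ℂ}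
    (hz : 1 ≤ ‖z‖) : evalTF (∑ i ∈ s, f i) z = ∑ i ∈ s, evalTF (f i) z := by
  classical
  induction s using Finset.induction_on with
  | empty => simpa using ev_zero z
  | insert a s ha ih =>
    rw [Finset.sum_insert ha, Finset.sum_insert ha, ev_add (hf a) (rh_sum s f hf) hz, ih]

theorem ev_continuousOn {f : TF} (hf : MemRHinfTF f) :
    ContinuousOn (evalTF f) {z : ℂ | ‖z‖ = 1} := by
  unfold evalTF
  refine ContinuousOn.div (Polynomial.continuous _).continuousOn
    (Polynomial.continuous _).continuousOn ?_
  intro z hz h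
  have := hf.2 z h
  simp only [Set.mem_ofPred_eq] at hz
  linarith

/-- Maximum modulus principle on the exterior of the unit disk for `RH∞` functions. -/
theorem ev_max {f : TF} (hf : MemRHinfTF f) {C : ℝ}
    (hC : ∀ z : ℂ, ‖z‖ = 1 → ‖evalTF f z‖ ≤ C) {z : ℂ} (hz : 1 ≤ ‖z‖) : ‖evalTF f z‖ ≤ C := by
  set N := f.denom.natDegree with hN
  have hnum : f.num.natDegree ≤ N := Polynomial.natDegree_le_natDegree hf.1
  set p := (f.num.reflect N) with hp
  set q := (f.denom.reflect N) with hq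
  let H : ℂ → ℂ := fun w =>
    Polynomial.eval₂ (algebraMap ℝ ℂ) w p / Polynomial.eval₂ (algebraMap ℝ ℂ) w q
  have key : ∀ x : ℂ, x ≠ 0 → H x⁻¹ = evalTF f x := by
    intro x hx
    let _ := invertibleOfNonzero hx
    have e1 := Polynomial.eval₂_reflect_mul_pow (algebraMap ℝ ℂ) x N f.num hnum
    have e2 := Polynomial.eval₂_reflect_mul_pow (algebraMap ℝ ℂ) x N f.denom le_rfl
    rw [invOf_eq_inv] at e1 e2
    rw [evalTF, Polynomial.eval_map, Polynomial.eval_map, ← e1, ← e2]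
    simp only [H]
    rw [mul_div_mul_right _ _ (pow_ne_zero N hx)]
  have hq0 : ∀ w : ℂ, ‖w‖ ≤ 1 → Polynomial.eval₂ (algebraMap ℝ ℂ) w q ≠ 0 := by
    intro w hw
    by_cases hw0 : w = 0
    · subst hw0
      rw [Polynomial.eval₂_at_zero, hq, Polynomial.coeff_reflect, Polynomial.revAt_le (Nat.zero_le _),
        Nat.sub_zero, hN, Polynomial.coeff_natDegree]
      simpa using RatFunc.denom_ne_zero f
    · have hx : w⁻¹ ≠ 0 := inv_ne_zero hw0
      let _ := invertibleOfNonzero hx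
      have e2 := Polynomial.eval₂_reflect_mul_pow (algebraMap ℝ ℂ) w⁻¹ N f.denom le_rfl
      rw [invOf_eq_inv, inv_inv] at e2
      intro h0
      rw [← hq, h0, zero_mul] at e2
      refine denom_ne hf.2 (z := w⁻¹) ?_ e2.symm
      rw [norm_inv]
      exact (one_le_inv₀ (norm_pos_iff.2 hw0)).2 hw
  have hd : DiffContOnCl ℂ H (Metric.ball 0 1) := by
    have : DifferentiableOn ℂ H (closure (Metric.ball 0 1)) := by
      rw [closure_ball (0 : ℂ) one_ne_zero]
      intro w hw
      have hw' : ‖w‖ ≤ 1 := by simpa using hw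
      refine DifferentiableAt.differentiableWithinAt ?_
      refine DifferentiableAt.div ?_ ?_ (hq0 w hw')
      · simp only [Polynomial.eval₂_eq_eval_map]; exact Polynomial.differentiableAt _
      · simp only [Polynomial.eval₂_eq_eval_map]; exact Polynomial.differentiableAt _
    exact this.diffContOnCl
  have hz0 : z ≠ 0 := by
    intro h; subst h; simp at hz; linarith
  rw [← key z hz0]
  refine Complex.norm_le_of_forall_mem_frontier_norm_le Metric.isBounded_ball hd ?_ ?_
  · intro w hw
    rw [frontier_ball (0 : ℂ) one_ne_zero] at hw
    have hw' : ‖w‖ = 1 := by simpa using hw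
    have hw0 : w⁻¹ ≠ 0 := by
      intro h; rw [inv_eq_zero] at h; subst h; simp at hw'
    have := key w⁻¹ hw0
    rw [inv_inv] at this
    rw [this]
    exact hC _ (by rw [norm_inv, hw', inv_one])
  · rw [closure_ball (0 : ℂ) one_ne_zero]
    simpa using inv_le_one_of_one_le₀ hz

theorem one_add_ne {h : TF} (hh : StrictlyProperTF h) : 1 + h ≠ 0 := by
  intro h0
  have : h = -1 := by linear_combination h0
  rw [sproper_iff, this, Valuation.map_neg, map_one] at hh
  exact lt_irrefl _ hh

theorem rh_neg {f : TF} (hf : MemRHinfTF f) : MemRHinfTF (-f) := by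
  have := rh_mul (rh_C (-1)) hf
  simpa using this

theorem ev_neg {f : TF} (hf : MemRHinfTF f) {z : ℂ} (hz : 1 ≤ ‖z‖) :
    evalTF (-f) z = - evalTF f z := by
  have := ev_mul (rh_C (-1)) hf hz
  rw [ev_C] at this
  simpa using this

theorem sp_neg {f : TF} (hf : StrictlyProperTF f) : StrictlyProperTF (-f) := by
  rw [sproper_iff] at *
  rwa [Valuation.map_neg]

/-- Small gain: `(1 - h)⁻¹ ∈ RH∞`. -/
theorem rh_inv {h : TF} (hh : MemRHinfTF h) (hs : StrictlyProperTF h) {C : ℝ} (hC1 : C < 1)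
    (hC : ∀ z : ℂ, ‖z‖ = 1 → ‖evalTF h z‖ ≤ C) : MemRHinfTF (1 - h)⁻¹ := by
  have hne : 1 - h ≠ 0 := by rw [sub_eq_add_neg]; exact one_add_ne (sp_neg hs)
  constructor
  · rw [proper_iff, map_inv₀]
    have hs' := (sproper_iff h).1 hs
    have : vinf (1 - h) = 1 := by
      rw [sub_eq_add_neg, Valuation.map_add_eq_of_lt_left]
      · simp
      · rw [Valuation.map_neg, map_one]; exact hs'
    rw [this, inv_one]
  · refine stable_of_dvd (RatFunc.denom_inv_dvd hne) ?_
    intro z hz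
    by_contra hlt
    rw [not_lt] at hlt
    have e : evalTF (1 - h) z = 0 := by rw [evalTF, hz, zero_div]
    rw [sub_eq_add_neg, ev_add rh_one (rh_neg hh) hlt, ev_one, ev_neg hh hlt] at e
    have e' : evalTF h z = 1 := by linear_combination -e
    have := ev_max hh hC hlt
    rw [e', norm_one] at this
    linarith

/-- A nonzero `RH∞` function is nonzero somewhere on the unit circle. -/
theorem exists_ev_ne {f : TF} (hf : MemRHinfTF f) (h0 : f ≠ 0) :
    ∃ z : ℂ, ‖z‖ = 1 ∧ evalTF f z ≠ 0 := by
  by_contra hcon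
  push Not at hcon
  have hmax : ∀ z : ℂ, 1 ≤ ‖z‖ → evalTF f z = 0 := by
    intro z hz
    have := ev_max hf (C := 0) (fun w hw => by rw [hcon w hw, norm_zero]) hz
    exact norm_le_zero_iff.1 this
  have hp : f.num.map (algebraMap ℝ ℂ) ≠ 0 := by
    rw [Polynomial.map_ne_zero_iff (algebraMap ℝ ℂ).injective]
    exact RatFunc.num_ne_zero h0
  refine hp (Polynomial.eq_zero_of_infinite_isRoot _ ?_)
  refine Set.infinite_of_injective_forall_mem (f := fun n : ℕ => ((n : ℂ) + 1)) ?_ ?_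
  · intro a b hab
    simpa using hab
  · intro n
    have hn : (1 : ℝ) ≤ ‖((n : ℂ) + 1)‖ := by
      have : ((n : ℂ) + 1) = ((n + 1 : ℕ) : ℂ) := by push_cast; rfl
      rw [this, Complex.norm_natCast]
      push_cast
      have := n.cast_nonneg (α := ℝ)
      linarith
    have := hmax _ hn
    rw [evalTF, div_eq_zero_iff] at this
    refine this.resolve_right ?_
    rw [Polynomial.eval_map]
    exact denom_ne hf.2 hn

/-! ### Spectral norm -/

section norms
open scoped Matrix.Norms.L2Operator

theorem specNorm_eq {m n : ℕ} (A : Matrix (Fin m) (Fin n) ℂ) : specNorm A = ‖A‖ := rfl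

theorem spec_nonneg {m n : ℕ} (A : Matrix (Fin m) (Fin n) ℂ) : 0 ≤ specNorm A := by
  rw [specNorm_eq]; exact norm_nonneg _

theorem spec_add {m n : ℕ} (A B : Matrix (Fin m) (Fin n) ℂ) :
    specNorm (A + B) ≤ specNorm A + specNorm B := by
  simp only [specNorm_eq]; exact norm_add_le _ _

theorem spec_mul {m n k : ℕ} (A : Matrix (Fin m) (Fin n) ℂ) (B : Matrix (Fin n) (Fin k) ℂ) :
    specNorm (A * B) ≤ specNorm A * specNorm B := by
  simp only [specNorm_eq]; exact Matrix.l2_opNorm_mul _ _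

theorem spec_smul {m n : ℕ} (c : ℂ) (A : Matrix (Fin m) (Fin n) ℂ) :
    specNorm (c • A) = ‖c‖ * specNorm A := by
  simp only [specNorm_eq]; exact norm_smul _ _

theorem spec_zero {m n : ℕ} : specNorm (0 : Matrix (Fin m) (Fin n) ℂ) = 0 := by
  simp only [specNorm_eq]; exact norm_zero

theorem spec_eq_zero {m n : ℕ} {A : Matrix (Fin m) (Fin n) ℂ} (h : specNorm A = 0) : A = 0 := by
  rw [specNorm_eq] at h; exact norm_eq_zero.1 h

theorem spec_one_one (A : Matrix (Fin 1) (Fin 1) ℂ) : specNorm A = ‖A 0 0‖ := by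
  have : A = Matrix.diagonal (fun _ => A 0 0) := by
    ext i j
    rw [Subsingleton.elim i 0, Subsingleton.elim j 0]; simp
  rw [specNorm_eq]
  conv_lhs => rw [this]
  rw [Matrix.l2_opNorm_diagonal, pi_norm_const]

theorem spec_continuous {m n : ℕ} :
    Continuous (fun A : Matrix (Fin m) (Fin n) ℂ => specNorm A) := by
  simp only [specNorm_eq]
  exact continuous_norm

theorem spec_row {n : ℕ} (d : Fin n → ℝ) :
    specNorm (Matrix.of fun (_ : Fin 1) j => (d j : ℂ)) = euclNorm d := by
  set A : Matrix (Fin 1) (Fin n) ℂ := Matrix.of fun (_ : Fin 1) j => (d j : ℂ) with hA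
  have h1 : ‖(Aᴴ)ᴴ * Aᴴ‖ = ‖Aᴴ‖ * ‖Aᴴ‖ := Matrix.l2_opNorm_conjTranspose_mul_self Aᴴ
  rw [Matrix.conjTranspose_conjTranspose, Matrix.l2_opNorm_conjTranspose] at h1
  have h2 : ‖A * Aᴴ‖ = ∑ i, d i ^ 2 := by
    rw [← specNorm_eq, spec_one_one]
    have : (A * Aᴴ) 0 0 = ((∑ i, d i ^ 2 : ℝ) : ℂ) := by
      simp [Matrix.mul_apply, hA, pow_two]
    rw [this, Complex.norm_real, Real.norm_of_nonneg]
    exact Finset.sum_nonneg fun i _ => sq_nonneg _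
  rw [euclNorm, ← h2, h1, Real.sqrt_mul_self (norm_nonneg _), specNorm_eq]

end norms

/-! ### Transfer matrices -/

theorem mrh_rmap {m n : ℕ} (A : Matrix (Fin m) (Fin n) ℝ) : MemRHinf (rmap A) :=
  fun i j => rh_C (A i j)

theorem mrh_add {m n : ℕ} {F G : TMat m n} (hF : MemRHinf F) (hG : MemRHinf G) :
    MemRHinf (F + G) := fun i j => rh_add (hF i j) (hG i j)

theorem mrh_mul {m n k : ℕ} {F : TMat m n} {G : TMat n k} (hF : MemRHinf F) (hG : MemRHinf G) :
    MemRHinf (F * G) := by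
  intro i j
  rw [Matrix.mul_apply]
  exact rh_sum _ _ fun l => rh_mul (hF i l) (hG l j)

theorem mrh_smul {m n : ℕ} {c : TF} {F : TMat m n} (hc : MemRHinfTF c) (hF : MemRHinf F) :
    MemRHinf (c • F) := fun i j => rh_mul hc (hF i j)

theorem mrh_col2 {a b : TF} (ha : MemRHinfTF a) (hb : MemRHinfTF b) : MemRHinf (col2 a b) := by
  intro i j
  simp only [col2, Matrix.of_apply]
  split_ifs
  · exact ha
  · exact hb

theorem msp_add {m n : ℕ} {F G : TMat m n} (hF : StrictlyProper F) (hG : StrictlyProper G) :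
    StrictlyProper (F + G) := fun i j => sp_add (hF i j) (hG i j)

theorem msp_mul {m n k : ℕ} {F : TMat m n} {G : TMat n k} (hF : MemRHinf F)
    (hG : StrictlyProper G) : StrictlyProper (F * G) := by
  intro i j
  rw [Matrix.mul_apply]
  exact sp_sum _ _ fun l => sp_mul_left (hF i l).1 (hG l j)

theorem msp_smul {m n : ℕ} {c : TF} {F : TMat m n} (hc : MemRHinfTF c) (hF : StrictlyProper F) :
    StrictlyProper (c • F) := fun i j => sp_mul_left hc.1 (hF i j)

theorem mev_add {m n : ℕ} {F G : TMat m n} (hF : MemRHinf F) (hG : MemRHinf G) {z : ℂ}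
    (hz : ‖z‖ = 1) : evalMat (F + G) z = evalMat F z + evalMat G z := by
  ext i j
  exact ev_add (hF i j) (hG i j) hz.ge

theorem mev_mul {m n k : ℕ} {F : TMat m n} {G : TMat n k} (hF : MemRHinf F) (hG : MemRHinf G)
    {z : ℂ} (hz : ‖z‖ = 1) : evalMat (F * G) z = evalMat F z * evalMat G z := by
  ext i j
  simp only [evalMat, Matrix.of_apply, Matrix.mul_apply]
  rw [ev_sum _ _ (fun l => rh_mul (hF i l) (hG l j)) hz.ge]
  exact Finset.sum_congr rfl fun l _ => ev_mul (hF i l) (hG l j) hz.ge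

theorem mev_smul {m n : ℕ} {c : TF} {F : TMat m n} (hc : MemRHinfTF c) (hF : MemRHinf F) {z : ℂ}
    (hz : ‖z‖ = 1) : evalMat (c • F) z = evalTF c z • evalMat F z := by
  ext i j
  exact ev_mul hc (hF i j) hz.ge

theorem mev_row {n : ℕ} (d : Fin n → ℝ) (z : ℂ) :
    evalMat (rmap (rowVec d)) z = Matrix.of fun (_ : Fin 1) j => (d j : ℂ) := by
  ext i j
  exact ev_C (d j) z

theorem hinf_nonneg {m n : ℕ} (F : TMat m n) : 0 ≤ hinfNorm F := by
  apply Real.sSup_nonneg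
  rintro x ⟨z, _, rfl⟩
  exact spec_nonneg _

theorem hinf_le {m n : ℕ} {F : TMat m n} {b : ℝ}
    (h : ∀ z : ℂ, ‖z‖ = 1 → specNorm (evalMat F z) ≤ b) : hinfNorm F ≤ b := by
  apply csSup_le
  · exact ⟨_, 1, norm_one, rfl⟩
  · rintro x ⟨z, hz, rfl⟩
    exact h z hz

theorem le_hinf {m n : ℕ} {F : TMat m n} (hF : MemRHinf F) {z : ℂ} (hz : ‖z‖ = 1) :
    specNorm (evalMat F z) ≤ hinfNorm F := by
  refine le_csSup ?_ ⟨z, hz, rfl⟩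
  have hc : IsCompact {z : ℂ | ‖z‖ = 1} := by
    have : {z : ℂ | ‖z‖ = 1} = Metric.sphere 0 1 := by ext; simp
    rw [this]; exact isCompact_sphere _ _
  have hcont : ContinuousOn (fun z => specNorm (evalMat F z)) {z : ℂ | ‖z‖ = 1} := by
    refine spec_continuous.comp_continuousOn ?_
    refine continuousOn_pi.2 fun i => continuousOn_pi.2 fun j => ?_
    exact ev_continuousOn (hF i j)
  have := (hc.image_of_continuousOn hcont).bddAbove
  refine this.mono ?_
  rintro x ⟨w, hw, rfl⟩
  exact ⟨w, hw, rfl⟩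

/-! ### Algebra of the Sherman–Morrison perturbation -/

theorem sMulTF_eq {m n : ℕ} (c : TF) (M : TMat m n) : sMulTF c M = c • M := rfl

theorem one_by_one (A : TMat 1 1) : A = (A 0 0) • (1 : TMat 1 1) := by
  ext i j
  rw [Subsingleton.elim i 0, Subsingleton.elim j 0]; simp

theorem rmap_row_add {n : ℕ} (g d : Fin n → ℝ) :
    rmap (rowVec (g + d)) = rmap (rowVec g) + rmap (rowVec d) := by
  ext i j
  simp [rmap, rowVec]

section algebra
variable {n : ℕ} (A : Matrix (Fin n) (Fin n) ℝ) (B : Matrix (Fin n) (Fin 1) ℝ)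
  (g d : Fin n → ℝ) (Θ : Response n 1 1)

/-- The scalar `dᵀN`. -/
def sS : TF := (rmap (rowVec d) * Θ.N) 0 0

/-- The scalar `(1 - dᵀN)⁻¹`. -/
def cS : TF := (1 - sS d Θ)⁻¹

theorem dN_eq : rmap (rowVec d) * Θ.N = sS d Θ • (1 : TMat 1 1) := one_by_one _

theorem c_rel (h : 1 - sS d Θ ≠ 0) : cS d Θ = 1 + cS d Θ * sS d Θ := by
  have : cS d Θ * (1 - sS d Θ) = 1 := inv_mul_cancel₀ h
  linear_combination this

theorem sm_R : (smPerturb d Θ).R = Θ.R + cS d Θ • (Θ.N * (rmap (rowVec d) * Θ.R)) := by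
  rw [← Matrix.mul_assoc]; rfl

theorem sm_M : (smPerturb d Θ).M = Θ.M + cS d Θ • (Θ.L * (rmap (rowVec d) * Θ.R)) := by
  rw [← Matrix.mul_assoc]; rfl

theorem sm_N (h : 1 - sS d Θ ≠ 0) : (smPerturb d Θ).N = cS d Θ • Θ.N := by
  have : (smPerturb d Θ).N = Θ.N + cS d Θ • (Θ.N * (rmap (rowVec d) * Θ.N)) := by
    rw [← Matrix.mul_assoc]; rfl
  rw [this, dN_eq, Matrix.mul_smul, Matrix.mul_one, smul_smul]
  conv_rhs => rw [c_rel d Θ h]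
  rw [add_smul, one_smul]

theorem sm_L (h : 1 - sS d Θ ≠ 0) : (smPerturb d Θ).L = cS d Θ • Θ.L := by
  have : (smPerturb d Θ).L = Θ.L + cS d Θ • (Θ.L * (rmap (rowVec d) * Θ.N)) := by
    rw [← Matrix.mul_assoc]; rfl
  rw [this, dN_eq, Matrix.mul_smul, Matrix.mul_one, smul_smul]
  conv_rhs => rw [c_rel d Θ h]
  rw [add_smul, one_smul]

theorem sm_eq1 (h1 : zIA A * Θ.R - rmap B * Θ.M = 1) (h2 : zIA A * Θ.N - rmap B * Θ.L = 0) :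
    zIA A * (smPerturb d Θ).R - rmap B * (smPerturb d Θ).M = 1 := by
  rw [sub_eq_zero] at h2
  rw [sm_R, sm_M, Matrix.mul_add, Matrix.mul_add, Matrix.mul_smul, Matrix.mul_smul,
    ← Matrix.mul_assoc (zIA A), h2, ← Matrix.mul_assoc (rmap B), add_sub_add_right_eq_sub, h1]

theorem sm_eq2 (h : 1 - sS d Θ ≠ 0) (h2 : zIA A * Θ.N - rmap B * Θ.L = 0) :
    zIA A * (smPerturb d Θ).N - rmap B * (smPerturb d Θ).L = 0 := by
  rw [sm_N _ _ h, sm_L _ _ h, Matrix.mul_smul, Matrix.mul_smul, ← smul_sub, h2, smul_zero]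

theorem sm_eq34 {k : ℕ} (h : 1 - sS d Θ ≠ 0) (h3 : Θ.R * zIA A - Θ.N * rmap (rowVec g) = 1)
    (X : TMat k n) (Y : TMat k 1) (W : TMat k n) (hX : X * zIA A - Y * rmap (rowVec g) = W) :
    (X + cS d Θ • (Y * (rmap (rowVec d) * Θ.R))) * zIA A
      - (cS d Θ • Y) * rmap (rowVec (g + d)) = W := by
  rw [sub_eq_iff_eq_add] at h3 hX
  rw [rmap_row_add, Matrix.add_mul, hX, Matrix.smul_mul, Matrix.mul_assoc Y, Matrix.mul_assoc _ Θ.R,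
    h3, Matrix.mul_add, Matrix.mul_one, ← Matrix.mul_assoc _ Θ.N, dN_eq, Matrix.smul_mul,
    Matrix.one_mul, Matrix.mul_add, Matrix.mul_smul, Matrix.smul_mul, Matrix.mul_add]
  have hc := c_rel d Θ h
  generalize cS d Θ = c at *
  generalize sS d Θ = s at *
  generalize Y * rmap (rowVec g) = P
  generalize Y * rmap (rowVec d) = Q
  ext i j
  simp only [Matrix.add_apply, Matrix.sub_apply, Matrix.smul_apply, smul_eq_mul]
  linear_combination (-(P i j)) * hc

theorem sm_achieves (h : 1 - sS d Θ ≠ 0) (hdet : 1 + (rmap (rowVec g) * Θ.N) 0 0 ≠ 0)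
    (h1 : zIA A * Θ.R - rmap B * Θ.M = 1) (h2 : zIA A * Θ.N - rmap B * Θ.L = 0)
    (h3 : Θ.R * zIA A - Θ.N * rmap (rowVec g) = 1)
    (h4 : Θ.M * zIA A - Θ.L * rmap (rowVec g) = 0) :
    Achieves A B (rowVec (g + d)) (controller Θ) (smPerturb d Θ) := by
  have hR : IsUnit Θ.R.det := by
    rw [sub_eq_iff_eq_add] at h3
    have e : Θ.R.det * (zIA A).det = 1 + (rmap (rowVec g) * Θ.N) 0 0 := by
      rw [← Matrix.det_mul, h3, Matrix.det_one_add_mul_comm, Matrix.det_fin_one]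
      simp
    rw [isUnit_iff_ne_zero]
    intro h0
    rw [h0, zero_mul] at e
    exact hdet e.symm
  set K := controller Θ with hK
  have hKdef : K = Θ.L - Θ.M * Θ.R⁻¹ * Θ.N := rfl
  have hMR : Θ.M * Θ.R⁻¹ = K * rmap (rowVec g) := by
    rw [sub_eq_iff_eq_add] at h3
    rw [sub_eq_zero] at h4
    have e : Θ.M * Θ.R⁻¹ * (1 + Θ.N * rmap (rowVec g)) = Θ.L * rmap (rowVec g) := by
      rw [← h3, ← h4, Matrix.mul_assoc Θ.M, Matrix.nonsing_inv_mul_cancel_left _ _ hR]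
    rw [Matrix.mul_add, Matrix.mul_one, ← Matrix.mul_assoc] at e
    rw [hKdef, Matrix.sub_mul, ← e, add_sub_cancel_right]
  have hM : Θ.M = K * (rmap (rowVec g) * Θ.R) := by
    rw [← Matrix.mul_assoc, ← hMR, Matrix.nonsing_inv_mul_cancel_right _ _ hR]
  have hL : Θ.L = K + K * (rmap (rowVec g) * Θ.N) := by
    rw [← Matrix.mul_assoc, ← hMR, hKdef, sub_add_cancel]
  have hc := c_rel d Θ h
  refine ⟨?_, ?_, ?_, ?_⟩
  · have := sm_eq1 A B d Θ h1 h2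
    rw [sub_eq_iff_eq_add] at this
    rw [this, add_comm]
  · have := sm_eq2 A B d Θ h h2
    rwa [sub_eq_zero] at this
  · rw [sm_M, sm_R, rmap_row_add]
    rw [hM, hL]
    simp only [Matrix.mul_add, Matrix.add_mul, Matrix.mul_smul, Matrix.mul_assoc]
    rw [← Matrix.mul_assoc (rmap (rowVec d)) Θ.N, dN_eq, Matrix.smul_mul, Matrix.one_mul,
      Matrix.mul_smul]
    generalize cS d Θ = c at *
    generalize sS d Θ = s at *
    generalize K * (rmap (rowVec g) * Θ.R) = P
    generalize K * (rmap (rowVec d) * Θ.R) = Q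
    generalize K * (rmap (rowVec g) * (Θ.N * (rmap (rowVec d) * Θ.R))) = T
    ext i j
    simp only [Matrix.add_apply, Matrix.smul_apply, smul_eq_mul]
    linear_combination (Q i j) * hc
  · rw [sm_L _ _ h, sm_N _ _ h, rmap_row_add]
    rw [hL]
    simp only [Matrix.mul_add, Matrix.add_mul, Matrix.mul_smul, Matrix.mul_assoc, smul_add]
    rw [dN_eq d, Matrix.mul_smul, Matrix.mul_one]
    generalize cS d Θ = c at *
    generalize sS d Θ = s at *
    generalize K * (rmap (rowVec g) * Θ.N) = P
    ext i j
    simp only [Matrix.add_apply, Matrix.smul_apply, smul_eq_mul]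
    linear_combination (K i j) * hc

end algebra

/-- The matrix whose norm is `cost`. -/
def costMat {n nw : ℕ} (g : Fin n → ℝ) (B₁ : Matrix (Fin n) (Fin nw) ℝ)
    (D₂₁ : Matrix (Fin 1) (Fin nw) ℝ) (D₁₁ : Matrix (Fin 2) (Fin nw) ℝ)
    (Θ : Response n 1 1) : TMat 2 nw :=
  (rmap (C1mat g) * Θ.R + rmap D12mat * Θ.M) * rmap B₁ +
    (rmap (C1mat g) * Θ.N + rmap D12mat * Θ.L) * rmap D₂₁ + rmap D₁₁

/-- The matrix `R B₁ + N D₂₁`. -/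
def SMat {n nw : ℕ} (B₁ : Matrix (Fin n) (Fin nw) ℝ)
    (D₂₁ : Matrix (Fin 1) (Fin nw) ℝ) (Θ : Response n 1 1) : TMat n nw :=
  Θ.R * rmap B₁ + Θ.N * rmap D₂₁

/-- The matrix `[1 + gᵀN; L]`. -/
def WMat {n : ℕ} (g : Fin n → ℝ) (Θ : Response n 1 1) : TMat 2 1 :=
  col2 (1 + (rmap (rowVec g) * Θ.N) 0 0) (Θ.L 0 0)

theorem C1_zero {n k : ℕ} (g : Fin n → ℝ) (X : TMat n k) (j : Fin k) :
    (rmap (C1mat g) * X) 0 j = (rmap (rowVec g) * X) 0 j := by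
  simp [Matrix.mul_apply, rmap, C1mat, rowVec]

theorem C1_one {n k : ℕ} (g : Fin n → ℝ) (X : TMat n k) (j : Fin k) :
    (rmap (C1mat g) * X) 1 j = 0 := by
  simp [Matrix.mul_apply, rmap, C1mat]

theorem D12_zero {k : ℕ} (X : TMat 1 k) (j : Fin k) : (rmap D12mat * X) 0 j = 0 := by
  simp [Matrix.mul_apply, rmap, D12mat]

theorem D12_one {k : ℕ} (X : TMat 1 k) (j : Fin k) : (rmap D12mat * X) 1 j = X 0 j := by
  simp [Matrix.mul_apply, rmap, D12mat]

section pert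
variable {n nw : ℕ} (g d : Fin n → ℝ) (B₁ : Matrix (Fin n) (Fin nw) ℝ)
    (D₂₁ : Matrix (Fin 1) (Fin nw) ℝ) (D₁₁ : Matrix (Fin 2) (Fin nw) ℝ)
    (Θ : Response n 1 1)

theorem WMat_pert (h : 1 - sS d Θ ≠ 0) :
    WMat (g + d) (smPerturb d Θ) = cS d Θ • WMat g Θ := by
  have hc := c_rel d Θ h
  have hs : (rmap (rowVec d) * Θ.N) 0 0 = sS d Θ := rfl
  rw [WMat, WMat, sm_N _ _ h, sm_L _ _ h, rmap_row_add, Matrix.mul_smul, Matrix.add_mul]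
  ext i j
  fin_cases i
  · simp [col2, hs]
    linear_combination -hc
  · simp [col2]

theorem SMat_pert (h : 1 - sS d Θ ≠ 0) :
    SMat B₁ D₂₁ (smPerturb d Θ) =
      SMat B₁ D₂₁ Θ + cS d Θ • (Θ.N * (rmap (rowVec d) * SMat B₁ D₂₁ Θ)) := by
  have hN : cS d Θ • Θ.N = Θ.N + cS d Θ • (Θ.N * (rmap (rowVec d) * Θ.N)) := by
    rw [← sm_N _ _ h, ← Matrix.mul_assoc]; rfl
  rw [SMat, SMat, sm_R, sm_N _ _ h, hN]
  simp only [Matrix.mul_add, Matrix.add_mul, Matrix.smul_mul, Matrix.mul_assoc, smul_add]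
  abel

theorem TMat_pert (h : 1 - sS d Θ ≠ 0) :
    (smPerturb d Θ).M * rmap B₁ + (smPerturb d Θ).L * rmap D₂₁ =
      Θ.M * rmap B₁ + Θ.L * rmap D₂₁ +
        cS d Θ • (Θ.L * (rmap (rowVec d) * SMat B₁ D₂₁ Θ)) := by
  have hL : cS d Θ • Θ.L = Θ.L + cS d Θ • (Θ.L * (rmap (rowVec d) * Θ.N)) := by
    rw [← sm_L _ _ h, ← Matrix.mul_assoc]; rfl
  rw [SMat, sm_M, sm_L _ _ h, hL]
  simp only [Matrix.mul_add, Matrix.add_mul, Matrix.smul_mul, Matrix.mul_assoc, smul_add]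
  abel

theorem costMat_eq : costMat g B₁ D₂₁ D₁₁ Θ =
    rmap (C1mat g) * SMat B₁ D₂₁ Θ + rmap D12mat * (Θ.M * rmap B₁ + Θ.L * rmap D₂₁)
      + rmap D₁₁ := by
  rw [costMat, SMat]
  simp only [Matrix.mul_add, Matrix.add_mul, Matrix.mul_assoc]
  abel

theorem costMat_pert (h : 1 - sS d Θ ≠ 0) :
    costMat (g + d) B₁ D₂₁ D₁₁ (smPerturb d Θ) =
      costMat g B₁ D₂₁ D₁₁ Θ +
        cS d Θ • (WMat g Θ * (rmap (rowVec d) * SMat B₁ D₂₁ Θ)) := by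
  have hc := c_rel d Θ h
  have hs : (rmap (rowVec g) * Θ.N) 0 0 = sS g Θ := rfl
  rw [costMat_eq, costMat_eq, TMat_pert _ _ _ _ h, SMat_pert _ _ _ _ h]
  generalize SMat B₁ D₂₁ Θ = S
  generalize Θ.M * rmap B₁ + Θ.L * rmap D₂₁ = T
  ext i j
  fin_cases i
  · simp only [Fin.zero_eta, Matrix.add_apply, C1_zero, D12_zero, Matrix.smul_apply, smul_eq_mul,
      rmap_row_add, Matrix.add_mul, Matrix.mul_add, Matrix.mul_smul]
    rw [← Matrix.mul_assoc _ Θ.N, ← Matrix.mul_assoc _ Θ.N, dN_eq d, dN_eq g,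
      Matrix.smul_mul, Matrix.smul_mul, Matrix.one_mul, Matrix.mul_apply (M := WMat g Θ)]
    simp only [Matrix.smul_apply, smul_eq_mul, Finset.univ_unique, Finset.sum_singleton, WMat, col2,
      Matrix.of_apply, Fin.default_eq_zero, Fin.val_zero, if_true, hs]
    linear_combination (-((rmap (rowVec d) * S) 0 j)) * hc
  · simp only [Fin.mk_one, Matrix.add_apply, C1_one, D12_one, Matrix.smul_apply, smul_eq_mul,
      Matrix.mul_add, Matrix.mul_smul]
    rw [Matrix.mul_apply (M := WMat g Θ), Matrix.mul_apply (M := Θ.L)]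
    simp [WMat, col2]
    ring

end pert

section bounds
variable {n nw : ℕ} {g d : Fin n → ℝ} (B₁ : Matrix (Fin n) (Fin nw) ℝ)
    (D₂₁ : Matrix (Fin 1) (Fin nw) ℝ) (D₁₁ : Matrix (Fin 2) (Fin nw) ℝ)
    {Θ : Response n 1 1} {A : Matrix (Fin n) (Fin n) ℝ} {B : Matrix (Fin n) (Fin 1) ℝ} {ε : ℝ}

theorem euclNorm_nonneg (x : Fin n → ℝ) : 0 ≤ euclNorm x := Real.sqrt_nonneg _

theorem sS_rh (hΘ : SLSStable Θ) : MemRHinfTF (sS d Θ) :=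
  mrh_mul (mrh_rmap _) hΘ.2.2.2.2.2.1 0 0

theorem sS_sp (hΘ : SLSStable Θ) : StrictlyProperTF (sS d Θ) :=
  msp_mul (mrh_rmap _) hΘ.2.2.1 0 0

theorem sub_ne (hΘ : SLSStable Θ) : 1 - sS d Θ ≠ 0 := by
  rw [sub_eq_add_neg]; exact one_add_ne (sp_neg (sS_sp hΘ))

theorem row_mul_bound {k : ℕ} (hd : euclNorm d ≤ ε) {X : TMat n k} (hX : MemRHinf X) {z : ℂ}
    (hz : ‖z‖ = 1) :
    specNorm (evalMat (rmap (rowVec d) * X) z) ≤ ε * hinfNorm X := by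
  rw [mev_mul (mrh_rmap _) hX hz]
  refine (spec_mul _ _).trans ?_
  rw [mev_row, spec_row]
  exact mul_le_mul hd (le_hinf hX hz) (spec_nonneg _) ((euclNorm_nonneg d).trans hd)

theorem sS_bound (hΘ : SLSStable Θ) (hd : euclNorm d ≤ ε) {z : ℂ} (hz : ‖z‖ = 1) :
    ‖evalTF (sS d Θ) z‖ ≤ ε * hinfNorm Θ.N := by
  have := row_mul_bound hd hΘ.2.2.2.2.2.1 hz
  rwa [spec_one_one] at this

theorem cS_rh (hΘ : SLSStable Θ) (hd : euclNorm d ≤ ε) (h1 : ε * hinfNorm Θ.N < 1) :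
    MemRHinfTF (cS d Θ) :=
  rh_inv (sS_rh hΘ) (sS_sp hΘ) h1 fun _ hz => sS_bound hΘ hd hz

theorem cS_bound (hΘ : SLSStable Θ) (hd : euclNorm d ≤ ε) (h1 : ε * hinfNorm Θ.N < 1) {z : ℂ}
    (hz : ‖z‖ = 1) : ‖evalTF (cS d Θ) z‖ ≤ (1 - ε * hinfNorm Θ.N)⁻¹ := by
  have hc := cS_rh hΘ hd h1
  have hs := sS_rh (d := d) hΘ
  have e := congrArg (fun f => evalTF f z) (c_rel d Θ (sub_ne hΘ))
  rw [ev_add rh_one (rh_mul hc hs) hz.ge, ev_one, ev_mul hc hs hz.ge] at e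
  have hb := sS_bound hΘ hd hz
  have h2 : ‖evalTF (cS d Θ) z‖ ≤ 1 + ‖evalTF (cS d Θ) z‖ * (ε * hinfNorm Θ.N) := by
    calc ‖evalTF (cS d Θ) z‖ = ‖1 + evalTF (cS d Θ) z * evalTF (sS d Θ) z‖ := by rw [← e]
      _ ≤ ‖(1 : ℂ)‖ + ‖evalTF (cS d Θ) z * evalTF (sS d Θ) z‖ := norm_add_le _ _
      _ ≤ _ := by
        rw [norm_one, norm_mul]
        gcongr
  rw [← one_div, le_div_iff₀ (by linarith)]
  linarith

theorem stable_pert (hΘ : SLSStable Θ) (hd : euclNorm d ≤ ε) (h1 : ε * hinfNorm Θ.N < 1) :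
    SLSStable (smPerturb d Θ) := by
  have hc := cS_rh hΘ hd h1
  have hne := sub_ne (d := d) hΘ
  obtain ⟨sR, sM, sN, rR, rM, rN, rL⟩ := hΘ
  have hdr := mrh_rmap (rowVec d)
  rw [SLSStable, sm_R, sm_M, sm_N _ _ hne, sm_L _ _ hne]
  refine ⟨msp_add sR (msp_smul hc (msp_mul rN (msp_mul hdr sR))),
    msp_add sM (msp_smul hc (msp_mul rL (msp_mul hdr sR))),
    msp_smul hc sN,
    mrh_add rR (mrh_smul hc (mrh_mul rN (mrh_mul hdr rR))),
    mrh_add rM (mrh_smul hc (mrh_mul rL (mrh_mul hdr rR))),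
    mrh_smul hc rN, mrh_smul hc rL⟩

theorem constraints_pert (hΘ : SLSConstraints A B (rowVec g) Θ) (hd : euclNorm d ≤ ε)
    (h1 : ε * hinfNorm Θ.N < 1) : SLSConstraints A B (rowVec (g + d)) (smPerturb d Θ) := by
  obtain ⟨e1, e2, e3, e4, hs⟩ := hΘ
  have hne := sub_ne (d := d) hs
  refine ⟨sm_eq1 A B d Θ e1 e2, sm_eq2 A B d Θ hne e2, ?_, ?_, stable_pert hs hd h1⟩
  · rw [sm_R, sm_N _ _ hne]
    exact sm_eq34 A g d Θ hne e3 _ _ _ e3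
  · rw [sm_M, sm_L _ _ hne]
    exact sm_eq34 A g d Θ hne e3 _ _ _ e4

theorem W_rh (hΘ : SLSStable Θ) : MemRHinf (WMat g Θ) :=
  mrh_col2 (rh_add rh_one (sS_rh hΘ)) (hΘ.2.2.2.2.2.2 0 0)

theorem S_rh (hΘ : SLSStable Θ) : MemRHinf (SMat B₁ D₂₁ Θ) :=
  mrh_add (mrh_mul hΘ.2.2.2.1 (mrh_rmap _)) (mrh_mul hΘ.2.2.2.2.2.1 (mrh_rmap _))

theorem costMat_rh (hΘ : SLSStable Θ) : MemRHinf (costMat g B₁ D₂₁ D₁₁ Θ) := by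
  obtain ⟨_, _, _, rR, rM, rN, rL⟩ := hΘ
  exact mrh_add (mrh_add
    (mrh_mul (mrh_add (mrh_mul (mrh_rmap _) rR) (mrh_mul (mrh_rmap _) rM)) (mrh_rmap _))
    (mrh_mul (mrh_add (mrh_mul (mrh_rmap _) rN) (mrh_mul (mrh_rmap _) rL)) (mrh_rmap _)))
    (mrh_rmap _)

theorem smul_bound {m k : ℕ} {c : TF} {X : TMat m k} {b : ℝ} (hc : MemRHinfTF c)
    (hX : MemRHinf X) (hb : ∀ z : ℂ, ‖z‖ = 1 → ‖evalTF c z‖ ≤ b) :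
    hinfNorm (c • X) ≤ b * hinfNorm X := by
  refine hinf_le fun z hz => ?_
  rw [mev_smul hc hX hz, spec_smul]
  exact mul_le_mul (hb z hz) (le_hinf hX hz) (spec_nonneg _) ((norm_nonneg _).trans (hb z hz))

theorem add_bound {m k : ℕ} {c : TF} {X : TMat m k} {Y : TMat m 1} {S : TMat n k} {b : ℝ}
    (hc : MemRHinfTF c) (hX : MemRHinf X) (hY : MemRHinf Y) (hS : MemRHinf S)
    (hd : euclNorm d ≤ ε) (hb : ∀ z : ℂ, ‖z‖ = 1 → ‖evalTF c z‖ ≤ b) :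
    hinfNorm (X + c • (Y * (rmap (rowVec d) * S))) ≤
      hinfNorm X + b * (hinfNorm Y * (ε * hinfNorm S)) := by
  refine hinf_le fun z hz => ?_
  have hdS := mrh_mul (mrh_rmap (rowVec d)) hS
  have hYS := mrh_mul hY hdS
  rw [mev_add hX (mrh_smul hc hYS) hz, mev_smul hc hYS hz, mev_mul hY hdS hz]
  refine (spec_add _ _).trans (add_le_add (le_hinf hX hz) ?_)
  rw [spec_smul]
  refine mul_le_mul (hb z hz) ?_ (spec_nonneg _) ((norm_nonneg _).trans (hb z hz))
  refine (spec_mul _ _).trans ?_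
  exact mul_le_mul (le_hinf hY hz) (row_mul_bound hd hS hz) (spec_nonneg _) (hinf_nonneg _)

theorem perf_pert (hΘ : SLSStable Θ) (hd : euclNorm d ≤ ε) (h1 : ε * hinfNorm Θ.N < 1) :
    perfWeight (g + d) (smPerturb d Θ) ≤ (1 - ε * hinfNorm Θ.N)⁻¹ * perfWeight g Θ := by
  change hinfNorm (WMat (g + d) (smPerturb d Θ)) ≤ _ * hinfNorm (WMat g Θ)
  rw [WMat_pert _ _ _ (sub_ne hΘ)]
  exact smul_bound (cS_rh hΘ hd h1) (W_rh hΘ) fun _ hz => cS_bound hΘ hd h1 hz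

theorem N_pert (hΘ : SLSStable Θ) (hd : euclNorm d ≤ ε) (h1 : ε * hinfNorm Θ.N < 1) :
    hinfNorm (smPerturb d Θ).N ≤ (1 - ε * hinfNorm Θ.N)⁻¹ * hinfNorm Θ.N := by
  rw [sm_N _ _ (sub_ne hΘ)]
  exact smul_bound (cS_rh hΘ hd h1) hΘ.2.2.2.2.2.1 fun _ hz => cS_bound hΘ hd h1 hz

theorem S_pert (hΘ : SLSStable Θ) (hd : euclNorm d ≤ ε) (h1 : ε * hinfNorm Θ.N < 1) :
    hinfNorm ((smPerturb d Θ).R * rmap B₁ + (smPerturb d Θ).N * rmap D₂₁) ≤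
      (1 - ε * hinfNorm Θ.N)⁻¹ * hinfNorm (Θ.R * rmap B₁ + Θ.N * rmap D₂₁) := by
  change hinfNorm (SMat B₁ D₂₁ (smPerturb d Θ)) ≤ _ * hinfNorm (SMat B₁ D₂₁ Θ)
  rw [SMat_pert _ _ _ _ (sub_ne hΘ)]
  refine (add_bound (cS_rh hΘ hd h1) (S_rh B₁ D₂₁ hΘ) hΘ.2.2.2.2.2.1 (S_rh B₁ D₂₁ hΘ) hd
    fun _ hz => cS_bound hΘ hd h1 hz).trans (le_of_eq ?_)
  have : 1 - ε * hinfNorm Θ.N ≠ 0 := by linarith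
  field_simp
  ring

theorem cost_pert (hΘ : SLSStable Θ) (hd : euclNorm d ≤ ε) (h1 : ε * hinfNorm Θ.N < 1) :
    cost (g + d) B₁ D₂₁ D₁₁ (smPerturb d Θ) ≤ cost g B₁ D₂₁ D₁₁ Θ +
      (1 - ε * hinfNorm Θ.N)⁻¹ *
        (perfWeight g Θ * (ε * hinfNorm (Θ.R * rmap B₁ + Θ.N * rmap D₂₁))) := by
  change hinfNorm (costMat (g + d) B₁ D₂₁ D₁₁ (smPerturb d Θ)) ≤
    hinfNorm (costMat g B₁ D₂₁ D₁₁ Θ) + _ * (hinfNorm (WMat g Θ) * (ε * hinfNorm (SMat B₁ D₂₁ Θ)))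
  rw [costMat_pert _ _ _ _ _ _ (sub_ne hΘ)]
  exact add_bound (cS_rh hΘ hd h1) (costMat_rh B₁ D₂₁ D₁₁ hΘ) (W_rh hΘ) (S_rh B₁ D₂₁ hΘ) hd
    fun _ hz => cS_bound hΘ hd h1 hz

theorem perf_pos (hΘ : SLSStable Θ) : 0 < perfWeight g Θ := by
  have hW := W_rh (g := g) hΘ
  have hne : 1 + sS g Θ ≠ 0 := one_add_ne (sS_sp hΘ)
  obtain ⟨z, hz, hz0⟩ := exists_ev_ne (rh_add rh_one (sS_rh hΘ)) hne
  refine lt_of_lt_of_le (lt_of_le_of_ne (spec_nonneg (evalMat (WMat g Θ) z)) ?_) (le_hinf hW hz)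
  intro h0
  have := congrFun (congrFun (spec_eq_zero h0.symm) 0) 0
  exact hz0 this

end bounds

theorem real_feas {ε x w N' w' : ℝ} (hε : 0 ≤ ε) (ha : 0 < 1 - ε * x) (hb : 0 < 1 - 2 * ε * x)
    (hw : 0 < w) (hN : N' ≤ (1 - ε * x)⁻¹ * x) (hw' : w' ≤ (1 - ε * x)⁻¹ * w) :
    ε * (w / (1 - 2 * ε * x)) * N' + w' ≤ w / (1 - 2 * ε * x) := by
  have h0 : 0 ≤ ε * (w / (1 - 2 * ε * x)) := mul_nonneg hε (div_pos hw hb).le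
  have q := mul_le_mul_of_nonneg_left hN h0
  refine (add_le_add q hw').trans (le_of_eq ?_)
  have := ha.ne'
  have := hb.ne'
  generalize hbe : 1 - 2 * ε * x = b at *
  field_simp
  rw [← hbe]
  ring

theorem real_cost {ε x w S : ℝ} (ha : 0 < 1 - ε * x) (hb : 0 < 1 - 2 * ε * x) :
    (1 - ε * x)⁻¹ * (w * (ε * S)) + ε * (w / (1 - 2 * ε * x)) * ((1 - ε * x)⁻¹ * S) =
      2 * ε / (1 - 2 * ε * x) * w * S := by
  have := ha.ne'
  have := hb.ne'
  generalize hbe : 1 - 2 * ε * x = b at *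
  field_simp
  rw [← hbe]
  ring

end SLSProof

open SLSProof

/-- suboptimality of robust SLS: with `Θ₀` a minimizer of `J(g, ·)`
over SLS-feasible responses for the true plant `(Z, e₁, gᵀ)`, `‖g − g̃‖₂ ≤ ε`,
`ε < 1/(2‖N₀‖)`, and `(Θ̃*, α*)` a minimizer of the robust SLS problem for `g̃` with
uncertainty parameter `ε`, the controller `K̃*` internally stabilizes the true plant
and its achieved closed-loop response `Θ̂*` satisfies
`J(g, Θ̂*) − J(g, Θ₀) ≤ (2ε/(1 − 2ε‖N₀‖))·‖[1 + gᵀN₀; L₀]‖·‖R₀B₁ + N₀D₂₁‖`. -/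
theorem statement_11 (r nw : ℕ) (g gt : Fin (r - 1) → ℝ)
    (B₁ : Matrix (Fin (r - 1)) (Fin nw) ℝ) (D₂₁ : Matrix (Fin 1) (Fin nw) ℝ)
    (D₁₁ : Matrix (Fin 2) (Fin nw) ℝ) (Θ₀ Θt : Response (r - 1) 1 1) (ε α : ℝ)
    (hopt : OptimalResponse g B₁ D₂₁ D₁₁ Θ₀)
    (hδ : euclNorm (g - gt) ≤ ε)
    (hε : ε < 1 / (2 * hinfNorm Θ₀.N))
    (hrob : RobustOptimal gt B₁ D₂₁ D₁₁ ε Θt α) :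
    ∃ Θhat : Response (r - 1) 1 1,
      Achieves (shiftMat (r - 1)) (e1 (r - 1)) (rowVec g) (controller Θt) Θhat ∧
      SLSStable Θhat ∧
      cost g B₁ D₂₁ D₁₁ Θhat - cost g B₁ D₂₁ D₁₁ Θ₀ ≤
        2 * ε / (1 - 2 * ε * hinfNorm Θ₀.N) * perfWeight g Θ₀ *
          hinfNorm (Θ₀.R * rmap B₁ + Θ₀.N * rmap D₂₁) := by
  obtain ⟨hc0, -⟩ := hopt
  obtain ⟨⟨hα, hct, hfe⟩, hmin⟩ := hrob
  have hs0 := hc0.2.2.2.2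
  have hst := hct.2.2.2.2
  have hε0 : 0 ≤ ε := (euclNorm_nonneg _).trans hδ
  have hn0 := hinf_nonneg Θ₀.N
  have hnt := hinf_nonneg Θt.N
  have hlt2 : 2 * ε * hinfNorm Θ₀.N < 1 := by
    rcases hn0.eq_or_lt with h | h
    · rw [← h]; simp
    · rw [lt_div_iff₀ (by linarith)] at hε
      linarith
  have hlt : ε * hinfNorm Θ₀.N < 1 := by nlinarith
  have hδ' : euclNorm (gt - g) ≤ ε := by
    have : euclNorm (gt - g) = euclNorm (g - gt) := by
      unfold euclNorm
      congr 1
      refine Finset.sum_congr rfl fun i _ => ?_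
      simp only [Pi.sub_apply]
      ring
    rwa [this]
  have hWt := perf_pos (g := gt) hst
  have hltt : ε * hinfNorm Θt.N < 1 := by
    by_contra hcon
    rw [not_lt] at hcon
    nlinarith
  have hg1 : gt + (g - gt) = g := by abel
  have hg2 : g + (gt - g) = gt := by abel
  refine ⟨smPerturb (g - gt) Θt, ?_, stable_pert hst hδ hltt, ?_⟩
  · have := sm_achieves (shiftMat (r - 1)) (e1 (r - 1)) gt (g - gt) Θt (sub_ne hst)
      (one_add_ne (sS_sp hst)) hct.1 hct.2.1 hct.2.2.1 hct.2.2.2.1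
    rwa [hg1] at this
  · have hcost := cost_pert (g := gt) B₁ D₂₁ D₁₁ hst hδ hltt
    rw [hg1] at hcost
    have hS0 := hinf_nonneg (Θ₀.R * rmap B₁ + Θ₀.N * rmap D₂₁)
    have hSt := hinf_nonneg (Θt.R * rmap B₁ + Θt.N * rmap D₂₁)
    have hW0 := perf_pos (g := g) hs0
    have p1 := constraints_pert hc0 hδ' hlt
    have p2 := perf_pert (g := g) hs0 hδ' hlt
    have p3 := N_pert hs0 hδ' hlt
    have p4 := S_pert B₁ D₂₁ hs0 hδ' hlt
    have p5 := cost_pert (g := g) B₁ D₂₁ D₁₁ hs0 hδ' hlt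
    rw [hg2] at p1 p2 p5
    set Θ' := smPerturb (gt - g) Θ₀ with hΘ'
    have ha : 0 < 1 - ε * hinfNorm Θ₀.N := by linarith
    have hb : 0 < 1 - 2 * ε * hinfNorm Θ₀.N := by linarith
    set α' := perfWeight g Θ₀ / (1 - 2 * ε * hinfNorm Θ₀.N) with hα'
    have hα'0 : 0 < α' := div_pos hW0 hb
    have hfeas : RobustFeasible gt ε Θ' α' := by
      refine ⟨hα'0, p1, ?_⟩
      exact real_feas hε0 ha hb hW0 p3 p2
    have hQ := hmin Θ' α' hfeas
    have hu : cost g B₁ D₂₁ D₁₁ (smPerturb (g - gt) Θt) ≤ Qval gt B₁ D₂₁ D₁₁ ε Θt α := by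
      refine hcost.trans ?_
      unfold Qval
      have hk : (1 - ε * hinfNorm Θt.N)⁻¹ * perfWeight gt Θt ≤ α := by
        rw [inv_mul_le_iff₀ (by linarith)]
        linarith
      have := mul_le_mul_of_nonneg_right hk (mul_nonneg hε0 hSt)
      linarith
    have hl : Qval gt B₁ D₂₁ D₁₁ ε Θ' α' ≤ cost g B₁ D₂₁ D₁₁ Θ₀ +
        2 * ε / (1 - 2 * ε * hinfNorm Θ₀.N) * perfWeight g Θ₀ *
          hinfNorm (Θ₀.R * rmap B₁ + Θ₀.N * rmap D₂₁) := by
      unfold Qval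
      have q := mul_le_mul_of_nonneg_left p4 (mul_nonneg hε0 hα'0.le)
      refine (add_le_add p5 q).trans (le_of_eq ?_)
      rw [hα', add_assoc, real_cost ha hb]
    linarith
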